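/- arXiv:1805.07168 — 2 statements merged into one kernel-verified Lean document; each statement's English description precedes it below -/
import Mathlib

section
/- For d = 2 (alphabet {1, 2}) and every n ≥ 0, the sum over all fully reducible words w of length 2n of the number of indices i ∈ {1, …, 2n−1} with w_i = w_{i+1} equals n · binomial(2n, n). -/
open scoped Classical

/-- One step of the stack-based reduction: push the letter if the stack is empty or
its top differs from the current letter, otherwise pop the top. -/
def redStep {d : ℕ} (s : List (Fin d)) (a : Fin d) : List (Fin d) :=
  match s with
  | [] => [a]
  | b :: rest => if a = b then rest else a :: b :: rest

/-- The irreducible string of a word: the final stack content read from bottom to top. -/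
def irrOf {d N : ℕ} (w : Fin N → Fin d) : List (Fin d) :=
  ((List.ofFn w).foldl redStep []).reverse

/-- A word is fully reducible if its irreducible string is empty. -/
def FullyReducible {d N : ℕ} (w : Fin N → Fin d) : Prop := irrOf w = []

/-- The number of indices `i` with `w_i = w_{i+1}` (adjacent equal-letter pairs). -/
def pairsCount {d : ℕ} (l : List (Fin d)) : ℕ :=
  (List.zipWith (fun a b => decide (a = b)) l l.tail).count true

/-- Alternating stack of height `m` with top letter `a`. -/
def altStack : ℕ → Fin 2 → List (Fin 2)
  | 0, _ => []
  | m + 1, a => a :: altStack m (a + 1)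

/-- Sum of `f` over all binary words of length `N`. -/
def wordSum (N : ℕ) (f : List (Fin 2) → ℕ) : ℕ := ∑ w : Fin N → Fin 2, f (List.ofFn w)

theorem wordSum_zero (f : List (Fin 2) → ℕ) : wordSum 0 f = f [] := by
  simp [wordSum]

theorem sum_two (a : Fin 2) (f : Fin 2 → ℕ) : ∑ x, f x = f a + f (a + 1) := by
  fin_cases a
  · simp [Fin.sum_univ_two]
  · simp [Fin.sum_univ_two, add_comm]

theorem wordSum_succ (N : ℕ) (a : Fin 2) (f : List (Fin 2) → ℕ) :
    wordSum (N + 1) f = wordSum N (fun l => f (a :: l)) + wordSum N (fun l => f ((a + 1) :: l)) := by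
  rw [← sum_two a (fun x => wordSum N (fun l => f (x :: l)))]
  unfold wordSum
  rw [← (Fin.consEquiv (fun _ : Fin (N + 1) => Fin 2)).sum_comp, Fintype.sum_prod_type]
  simp [Fin.consEquiv, List.ofFn_succ]

theorem wordSum_add (N : ℕ) (f g : List (Fin 2) → ℕ) :
    wordSum N (fun l => f l + g l) = wordSum N f + wordSum N g := by
  simp [wordSum, Finset.sum_add_distrib]

/-- Words emptying the stack `s`. -/
def cntA (N : ℕ) (s : List (Fin 2)) : ℕ :=
  wordSum N (fun l => if l.foldl redStep s = [] then 1 else 0)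

/-- Pairs in words emptying the stack `s`, with previous letter `b`. -/
def cntP (N : ℕ) (s : List (Fin 2)) (b : Fin 2) : ℕ :=
  wordSum N (fun l => if l.foldl redStep s = [] then pairsCount (b :: l) else 0)

theorem pairs_cons (b x : Fin 2) (l : List (Fin 2)) :
    pairsCount (b :: x :: l) = pairsCount (x :: l) + (if b = x then 1 else 0) := by
  by_cases h : b = x <;> simp [pairsCount, h]

theorem add_one_ne (a : Fin 2) : a + 1 ≠ a := by
  fin_cases a <;> simp

theorem add_one_one (a : Fin 2) : a + 1 + 1 = a := by
  fin_cases a <;> rfl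

theorem redStep_len (s : List (Fin 2)) (a : Fin 2) : s.length ≤ (redStep s a).length + 1 := by
  unfold redStep
  split
  · simp
  · split_ifs <;> simp

theorem foldl_len (l s : List (Fin 2)) : s.length ≤ (l.foldl redStep s).length + l.length := by
  induction l generalizing s with
  | nil => simp
  | cons a l ih =>
    have := ih (redStep s a)
    have := redStep_len s a
    simp only [List.foldl_cons, List.length_cons]
    omega

theorem alt_len (m : ℕ) (a : Fin 2) : (altStack m a).length = m := by
  induction m generalizing a with
  | zero => rfl
  | succ m ih => simp [altStack, ih]

theorem step_same (m : ℕ) (a : Fin 2) : redStep (altStack (m + 1) a) a = altStack m (a + 1) := by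
  simp [altStack, redStep]

theorem step_diff (m : ℕ) (a : Fin 2) :
    redStep (altStack m a) (a + 1) = altStack (m + 1) (a + 1) := by
  cases m with
  | zero => simp [altStack, redStep]
  | succ m => simp [altStack, redStep, add_one_one]

theorem step_zero (a b : Fin 2) : redStep (altStack 0 a) b = altStack 1 b := by
  simp [altStack, redStep]

theorem not_empty (N : ℕ) (s : List (Fin 2)) (h : N < s.length) (w : Fin N → Fin 2) :
    (List.ofFn w).foldl redStep s ≠ [] := by
  intro h0
  have := foldl_len (List.ofFn w) s
  rw [h0] at this
  simp at this
  omega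

theorem cntA_big (N : ℕ) (s : List (Fin 2)) (h : N < s.length) : cntA N s = 0 := by
  unfold cntA wordSum
  exact Finset.sum_eq_zero (fun w _ => if_neg (not_empty N s h w))

theorem cntP_big (N : ℕ) (s : List (Fin 2)) (b : Fin 2) (h : N < s.length) : cntP N s b = 0 := by
  unfold cntP wordSum
  exact Finset.sum_eq_zero (fun w _ => if_neg (not_empty N s h w))

theorem cntA_succ (N : ℕ) (s : List (Fin 2)) (a : Fin 2) :
    cntA (N + 1) s = cntA N (redStep s a) + cntA N (redStep s (a + 1)) := by
  unfold cntA
  rw [wordSum_succ N a]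
  rfl

theorem cntP_aux (N : ℕ) (s : List (Fin 2)) (b x : Fin 2) :
    wordSum N (fun l => if (x :: l).foldl redStep s = [] then pairsCount (b :: x :: l) else 0)
      = cntP N (redStep s x) x + (if b = x then cntA N (redStep s x) else 0) := by
  unfold cntP cntA
  by_cases h : b = x
  · simp only [h, if_true, ← wordSum_add]
    congr 1
    funext l
    rw [List.foldl_cons, pairs_cons]
    split_ifs <;> simp_all
  · simp only [h, if_false, add_zero, List.foldl_cons, pairs_cons]

theorem cntP_succ (N : ℕ) (s : List (Fin 2)) (b a : Fin 2) :
    cntP (N + 1) s b = cntP N (redStep s a) a + (if b = a then cntA N (redStep s a) else 0)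
      + (cntP N (redStep s (a + 1)) (a + 1)
        + (if b = a + 1 then cntA N (redStep s (a + 1)) else 0)) := by
  rw [← cntP_aux, ← cntP_aux, ← wordSum_succ N a (fun l =>
    if l.foldl redStep s = [] then pairsCount (b :: l) else 0)]
  rfl

theorem cntA_eq (N : ℕ) : ∀ (m k : ℕ) (a : Fin 2), N = m + 2 * k →
    cntA N (altStack m a) = N.choose k := by
  induction N with
  | zero =>
    intro m k a h
    obtain rfl : m = 0 := by omega
    obtain rfl : k = 0 := by omega
    simp [cntA, wordSum_zero, altStack]
  | succ N ih =>
    intro m k a h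
    rw [cntA_succ N _ a]
    cases m with
    | zero =>
      obtain ⟨j, rfl⟩ : ∃ j, k = j + 1 := ⟨k - 1, by omega⟩
      rw [step_zero, step_zero, ih 1 j _ (by omega), ih 1 j _ (by omega), Nat.choose_succ_succ]
      congr 1
      apply Nat.choose_symm_of_eq_add
      omega
    | succ m =>
      rw [step_same, step_diff, ih m k _ (by omega)]
      cases k with
      | zero => rw [cntA_big _ _ (by rw [alt_len]; omega)]; simp
      | succ j =>
        rw [ih (m + 1 + 1) j _ (by omega), Nat.choose_succ_succ]
        simp only [Nat.succ_eq_add_one]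
        omega

theorem cntP_eq (N : ℕ) :
    (∀ (m k : ℕ) (a : Fin 2), N = m + 1 + 2 * k →
      cntP N (altStack (m + 1) a) a = (m + 2 * k).choose k * (2 * k + 1)) ∧
    (∀ (m : ℕ) (a : Fin 2), N = m → cntP N (altStack m a) (a + 1) = 0) ∧
    (∀ (m j : ℕ) (a : Fin 2), N = m + 2 * j + 2 →
      cntP N (altStack m a) (a + 1) =
        2 * (j + 1) * (m + 2 * j + 1).choose (j + 1) + (m + 2 * j + 1).choose j) := by
  induction N with
  | zero =>
    refine ⟨fun m k a h => by omega, fun m a h => ?_, fun m j a h => by omega⟩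
    subst h
    simp [cntP, wordSum_zero, altStack, pairsCount]
  | succ N ih =>
    obtain ⟨ih1, ih2, ih3⟩ := ih
    have ih1' : ∀ (m k : ℕ) (a : Fin 2), N = m + 1 + 2 * k →
        cntP N (altStack (m + 1) (a + 1)) (a + 1) = (m + 2 * k).choose k * (2 * k + 1) :=
      fun m k a h => ih1 m k (a + 1) h
    have ih2' : ∀ (m : ℕ) (a : Fin 2), N = m → cntP N (altStack m (a + 1)) a = 0 := by
      intro m a h
      have := ih2 m (a + 1) h
      rwa [add_one_one] at this
    have ih3' : ∀ (m j : ℕ) (a : Fin 2), N = m + 2 * j + 2 →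
        cntP N (altStack m (a + 1)) a =
        2 * (j + 1) * (m + 2 * j + 1).choose (j + 1) + (m + 2 * j + 1).choose j := by
      intro m j a h
      have := ih3 m j (a + 1) h
      rwa [add_one_one] at this
    refine ⟨fun m k a h => ?_, fun m a h => ?_, fun m j a h => ?_⟩
    · rw [cntP_succ N _ a a, step_same, step_diff, if_pos rfl, if_neg (add_one_ne a).symm,
        cntA_eq N m k _ (by omega)]
      cases k with
      | zero =>
        rw [ih2' m a (by omega), cntP_big _ _ _ (by rw [alt_len]; omega)]
        simp
      | succ j =>
        rw [ih3' m j a (by omega), ih1' (m + 1) j a (by omega)]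
        obtain rfl : N = m + 2 * j + 1 + 1 := by omega
        have e1 : m + 2 * (j + 1) = m + 2 * j + 1 + 1 := by ring
        have e2 : m + 1 + 2 * j = m + 2 * j + 1 := by ring
        rw [e1, e2, Nat.choose_succ_succ (m + 2 * j + 1) j]
        simp only [Nat.succ_eq_add_one]
        ring
    · subst h
      rw [cntP_succ N _ (a + 1) a, step_same, step_diff, if_neg (add_one_ne a), if_pos rfl,
        ih2' N a rfl, cntP_big _ _ _ (by rw [alt_len]; omega),
        cntA_big _ _ (by rw [alt_len]; omega)]
    · cases m with
      | zero =>
        rw [cntP_succ N _ (a + 1) a, step_zero, step_zero, if_neg (add_one_ne a), if_pos rfl,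
          ih1 0 j a (by omega), ih1' 0 j a (by omega), cntA_eq N 1 j _ (by omega)]
        obtain rfl : N = 2 * j + 1 := by omega
        have := Nat.add_one_mul_choose_eq (2 * j) j
        simp only [zero_add]
        linarith
      | succ m =>
        rw [cntP_succ N _ (a + 1) a, step_same, step_diff, if_neg (add_one_ne a), if_pos rfl,
          ih3' m j a (by omega), ih1' (m + 1) j a (by omega), cntA_eq N (m + 2) j _ (by omega)]
        obtain rfl : N = m + 2 * j + 1 + 1 := by omega
        have e1 : m + 1 + 2 * j + 1 = m + 2 * j + 1 + 1 := by ring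
        have e2 : m + 1 + 2 * j = m + 2 * j + 1 := by ring
        rw [e1, e2, Nat.choose_succ_succ (m + 2 * j + 1) j]
        simp only [Nat.succ_eq_add_one]
        ring

/-- for `d = 2`, the total number of adjacent equal-letter pairs summed
over all fully reducible words of length `2n` equals `n · binomial(2n, n)`. -/
theorem pf2_total_pairs_reducible (n : ℕ) :
    (∑ w : Fin (2 * n) → Fin 2,
        (if FullyReducible w then pairsCount (List.ofFn w) else 0))
      = n * Nat.choose (2 * n) n := by
  have key : (∑ w : Fin (2 * n) → Fin 2,
        (if FullyReducible w then pairsCount (List.ofFn w) else 0))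
      = wordSum (2 * n) (fun l => if l.foldl redStep [] = [] then pairsCount l else 0) := by
    unfold wordSum
    refine Finset.sum_congr rfl (fun w _ => ?_)
    simp only [FullyReducible, irrOf, List.reverse_eq_nil_iff]
  rw [key]
  cases n with
  | zero => simp [wordSum_zero, pairsCount]
  | succ j =>
    have e : 2 * (j + 1) = 2 * j + 1 + 1 := by ring
    rw [e, wordSum_succ _ 0]
    have h : ∀ a : Fin 2, wordSum (2 * j + 1) (fun l =>
        if (a :: l).foldl redStep [] = [] then pairsCount (a :: l) else 0)
        = (2 * j).choose j * (2 * j + 1) := by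
      intro a
      have := (cntP_eq (2 * j + 1)).1 0 j a (by omega)
      rw [zero_add, zero_add] at this
      rw [← this]
      rfl
    rw [h, h]
    have h1 := Nat.add_one_mul_choose_eq (2 * j) j
    have h2 : (2 * j + 1).choose j = (2 * j + 1).choose (j + 1) := by
      apply Nat.choose_symm_of_eq_add
      omega
    rw [Nat.choose_succ_succ (2 * j + 1) j]
    simp only [Nat.succ_eq_add_one]
    rw [h2]
    linarith
end

section
/- For every integer d ≥ 2, every k ≥ 1, every n ≥ 0, and every irreducible string x of length k over {1,…,d}, the number of words of length 2n + k whose irreducible string equals x is W_{n,k}^{(d)}(x) = Σ_{i=0}^{n} W_i^{(d)} · (d−1)^{n−i} · C_{n−i, k−1}, where W_i^{(d)} is the number of fully reducible words of length 2i and C_{m,j} = ((j+1)/(m+j+1))·binomial(2m+j, m). In particular this count does not depend on the choice of the irreducible string x of length k. -/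
open scoped Classical

/-- `W d m` is the number of fully reducible words of length `2m` over `{1,…,d}`. -/
noncomputable def W (d m : ℕ) : ℕ :=
  Nat.card {w : Fin (2 * m) → Fin d // FullyReducible w}

/-- `Wx d N x` is the number of words of length `N` over `{1,…,d}` whose irreducible
string equals `x`. -/
noncomputable def Wx (d N : ℕ) (x : List (Fin d)) : ℕ :=
  Nat.card {w : Fin N → Fin d // irrOf w = x}

/-- `Cnk m j = ((j+1)/(m+j+1)) · binomial(2m+j, m)`, as a real number. -/
noncomputable def Cnk (m j : ℕ) : ℝ :=
  ((j + 1) * Nat.choose (2 * m + j) m : ℝ) / ((m + j + 1 : ℕ) : ℝ)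

/-- Number of words of length `N` whose final stack (top first) is `s`. -/
noncomputable def stackCount (d N : ℕ) (s : List (Fin d)) : ℕ :=
  Nat.card {w : Fin N → Fin d // (List.ofFn w).foldl redStep [] = s}

theorem redStep_chain {d : ℕ} (s : List (Fin d)) (a : Fin d) (h : s.IsChain (· ≠ ·)) :
    (redStep s a).IsChain (· ≠ ·) := by
  cases s with
  | nil => simp [redStep]
  | cons b r =>
    by_cases hab : a = b
    · simpa [redStep, hab] using h.tail
    · simp only [redStep, hab, if_false]
      exact List.isChain_cons_cons.2 ⟨hab, h⟩

theorem foldl_chain {d : ℕ} (l s : List (Fin d)) (h : s.IsChain (· ≠ ·)) :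
    (l.foldl redStep s).IsChain (· ≠ ·) := by
  induction l generalizing s with
  | nil => simpa using h
  | cons a l ih => exact ih _ (redStep_chain s a h)

theorem redStep_eq_iff {d : ℕ} (t r : List (Fin d)) (a c : Fin d)
    (ht : t.IsChain (· ≠ ·)) (hr : (a :: r).IsChain (· ≠ ·)) :
    redStep t c = a :: r ↔ t = if c = a then r else c :: a :: r := by
  cases t with
  | nil =>
    by_cases h : c = a
    · simp [redStep, h]
    · simp [redStep, h]
  | cons b u =>
    by_cases h : c = a
    · subst h
      by_cases h2 : c = b
      · subst h2
        simp only [redStep, if_true]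
        constructor
        · rintro rfl
          simp at ht
        · rintro rfl
          simp at hr
      · simp [redStep, h2]
    · by_cases h2 : c = b
      · subst h2
        simp [redStep, h]
      · simp [redStep, h, h2, Ne.symm h2]

theorem stackCount_succ {d : ℕ} (N : ℕ) (a : Fin d) (r : List (Fin d))
    (hr : (a :: r).IsChain (· ≠ ·)) :
    stackCount d (N + 1) (a :: r) =
      ∑ c : Fin d, stackCount d N (if c = a then r else c :: a :: r) := by
  unfold stackCount
  rw [← Nat.card_sigma]
  symm
  refine Nat.card_congr ?_
  refine (Equiv.subtypeProdEquivSigmaSubtype (fun (c : Fin d) (w : Fin N → Fin d) =>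
    (List.ofFn w).foldl redStep [] = (if c = a then r else c :: a :: r))).symm.trans ?_
  refine (Fin.snocEquiv (fun _ : Fin (N + 1) => Fin d)).subtypeEquiv ?_
  rintro ⟨c, w⟩
  rw [List.ofFn_succ', List.concat_eq_append, List.foldl_append]
  simp only [Fin.snocEquiv, Equiv.coe_fn_mk, Fin.snoc_castSucc, Fin.snoc_last, List.foldl_cons,
    List.foldl_nil]
  exact (redStep_eq_iff _ r a c (foldl_chain _ _ List.isChain_nil) hr).symm

theorem stackCount_zero_eq {d : ℕ} (a : Fin d) (r : List (Fin d)) :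
    stackCount d 0 (a :: r) = 0 := by
  simp [stackCount]

theorem W_eq (d n : ℕ) : W d n = stackCount d (2 * n) [] := by
  simp [W, stackCount, FullyReducible, irrOf]

theorem Wx_eq (d N : ℕ) (x : List (Fin d)) : Wx d N x = stackCount d N x.reverse := by
  simp [Wx, stackCount, irrOf, List.reverse_eq_iff]

/-- Words with at most as many letters as the stack height. -/
theorem stackCount_big {d : ℕ} (N : ℕ) (s : List (Fin d)) (h : N < s.length) :
    stackCount d N s = 0 := by
  have key : ∀ l s : List (Fin d), (l.foldl redStep s).length ≤ s.length + l.length := by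
    intro l
    induction l with
    | nil => simp
    | cons a l ih =>
      intro s
      refine (ih _).trans ?_
      have : (redStep s a).length ≤ s.length + 1 := by
        cases s with
        | nil => simp [redStep]
        | cons b u =>
          simp only [redStep]
          split_ifs <;> simp <;> omega
      simp only [List.length_cons]
      omega
  unfold stackCount
  rw [Nat.card_eq_zero]
  left
  constructor
  rintro ⟨w, hw⟩
  have := key (List.ofFn w) []
  rw [hw] at this
  simp at this
  omega

theorem Cnk_zero (j : ℕ) : Cnk 0 j = 1 := by
  have : (j : ℝ) + 1 ≠ 0 := by positivity
  simp [Cnk, this]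

theorem Cnk_succ_zero (m : ℕ) : Cnk (m + 1) 0 = Cnk m 1 := by
  have h1 : ((m + 1 : ℕ) : ℝ) * Nat.choose (2 * m + 2) (m + 1) =
      2 * (m + 1) * Nat.choose (2 * m + 1) m := by
    have := Nat.add_one_mul_choose_eq (2 * m + 1) m
    have h : ((2 * m + 1 + 1 : ℕ) : ℝ) * Nat.choose (2 * m + 1) m
      = Nat.choose (2 * m + 2) (m + 1) * ((m + 1 : ℕ) : ℝ) := by exact_mod_cast this
    push_cast at h ⊢
    linarith
  have h2 : ((m : ℝ) + 1) ≠ 0 := by positivity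
  have h3 : ((m : ℝ) + 1 + 1) ≠ 0 := by positivity
  unfold Cnk
  simp only [Nat.mul_add, Nat.add_zero, Nat.mul_one]
  push_cast at h1 ⊢
  rw [div_left_inj' h3]
  apply mul_left_cancel₀ h2
  linarith

theorem Cnk_succ_succ (m j : ℕ) : Cnk (m + 1) (j + 1) = Cnk (m + 1) j + Cnk m (j + 2) := by
  have e1 : Nat.choose (2 * m + j + 3) (m + 1) =
      Nat.choose (2 * m + j + 2) m + Nat.choose (2 * m + j + 2) (m + 1) :=
    Nat.choose_succ_succ _ _
  have e2 := Nat.choose_succ_right_eq (2 * m + j + 2) m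
  have e3 : 2 * m + j + 2 - m = m + j + 2 := by omega
  rw [e3] at e2
  have e2' : (Nat.choose (2 * m + j + 2) (m + 1) : ℝ) * (m + 1) =
    Nat.choose (2 * m + j + 2) m * (m + j + 2) := by exact_mod_cast e2
  unfold Cnk
  rw [show 2 * (m + 1) + (j + 1) = 2 * m + j + 3 by ring,
    show 2 * (m + 1) + j = 2 * m + j + 2 by ring,
    show 2 * m + (j + 2) = 2 * m + j + 2 by ring, e1]
  push_cast
  have hA : (Nat.choose (2 * m + j + 2) (m + 1) : ℝ) =
    Nat.choose (2 * m + j + 2) m * (m + j + 2) / (m + 1) := by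
    rw [eq_div_iff (by positivity)]
    exact e2'
  rw [hA]
  have h1 : (m : ℝ) + 1 ≠ 0 := by positivity
  have h2 : (m : ℝ) + 1 + (j + 1) + 1 ≠ 0 := by positivity
  have h3 : (m : ℝ) + 1 + j + 1 ≠ 0 := by positivity
  have h4 : (m : ℝ) + (j + 2) + 1 ≠ 0 := by positivity
  field_simp
  ring

/-- The right-hand side, as a function of the stack height. -/
noncomputable def rhsG (d n : ℕ) : ℕ → ℝ
  | 0 => (W d n : ℝ)
  | j + 1 => ∑ i ∈ Finset.range (n + 1),
      (W d i : ℝ) * ((d : ℝ) - 1) ^ (n - i) * Cnk (n - i) j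

theorem rhsG_zero (d j : ℕ) : rhsG d 0 (j + 1) = rhsG d 0 j := by
  cases j <;> simp [rhsG, Cnk_zero]

theorem rhsG_succ (d n j : ℕ) :
    rhsG d (n + 1) (j + 1) = rhsG d (n + 1) j + ((d : ℝ) - 1) * rhsG d n (j + 2) := by
  cases j with
  | zero =>
    simp only [rhsG]
    rw [Finset.sum_range_succ, Finset.mul_sum, add_comm]
    congr 1
    · simp [Cnk_zero]
    · refine Finset.sum_congr rfl fun i hi => ?_
      have hi' := Finset.mem_range.1 hi
      rw [show n + 1 - i = (n - i) + 1 by omega, Cnk_succ_zero]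
      ring
  | succ j =>
    simp only [rhsG]
    rw [Finset.sum_range_succ, Finset.sum_range_succ _ (n + 1), Finset.mul_sum, add_right_comm,
      ← Finset.sum_add_distrib]
    congr 1
    · refine Finset.sum_congr rfl fun i hi => ?_
      have hi' := Finset.mem_range.1 hi
      rw [show n + 1 - i = (n - i) + 1 by omega, Cnk_succ_succ]
      ring
    · simp [Cnk_zero]

theorem stackCount_eq {d : ℕ} (n : ℕ) : ∀ s : List (Fin d), s.IsChain (· ≠ ·) →
    (stackCount d (2 * n + s.length) s : ℝ) = rhsG d n s.length := by
  induction n with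
  | zero =>
    intro s
    induction s with
    | nil => intro _; simp [rhsG, W_eq]
    | cons a r ih =>
      intro h
      rw [List.length_cons, ← Nat.add_assoc, stackCount_succ _ _ _ h, rhsG_zero, ← ih h.tail,
        Finset.sum_eq_single a]
      · simp
      · intro c _ hc
        rw [if_neg hc]
        exact stackCount_big _ _ (by simp)
      · simp
  | succ n ihn =>
    intro s
    induction s with
    | nil => intro _; simp [rhsG, W_eq]
    | cons a r ih =>
      intro h
      rw [List.length_cons, ← Nat.add_assoc, stackCount_succ _ _ _ h, rhsG_succ, ← ih h.tail,
        ← Finset.add_sum_erase _ _ (Finset.mem_univ a)]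
      push_cast
      rw [if_pos rfl]
      congr 1
      rw [Finset.sum_congr rfl (g := fun _ => rhsG d n (r.length + 2))]
      · have hd : 1 ≤ d := by have := a.isLt; omega
        rw [Finset.sum_const, Finset.card_erase_of_mem (Finset.mem_univ a)]
        simp [Nat.cast_sub hd]
      · intro c hc
        have hc' := Finset.ne_of_mem_erase hc
        rw [if_neg hc']
        have := ihn (c :: a :: r) (List.isChain_cons_cons.2 ⟨hc', h⟩)
        rw [List.length_cons, List.length_cons] at this
        rw [← this]
        congr 2
        ring

/-- for every `d ≥ 2`, `k ≥ 1`, `n ≥ 0` and every irreducible string `x`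
of length `k`, the number of words of length `2n + k` whose irreducible string equals
`x` is `W_{n,k}^{(d)}(x) = Σ_{i=0}^{n} W_i^{(d)} · (d−1)^{n−i} · C_{n−i, k−1}`;
in particular this count does not depend on the choice of `x`. -/
theorem pf_Wnk_recursion (d : ℕ) (hd : 2 ≤ d) (k : ℕ) (hk : 1 ≤ k) (n : ℕ)
    (x : List (Fin d)) (hlen : x.length = k) (hirr : x.Chain' (· ≠ ·)) :
    (Wx d (2 * n + k) x : ℝ) =
      ∑ i ∈ Finset.range (n + 1),
        (W d i : ℝ) * ((d : ℝ) - 1) ^ (n - i) * Cnk (n - i) (k - 1) := by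
  obtain ⟨j, rfl⟩ : ∃ j, k = j + 1 := ⟨k - 1, by omega⟩
  have hrev : x.reverse.IsChain (· ≠ ·) := by
    rw [List.isChain_reverse]
    exact hirr.imp fun _ _ h => h.symm
  have := stackCount_eq n x.reverse hrev
  rw [List.length_reverse, hlen] at this
  rw [Wx_eq, this]
  simp [rhsG]
end
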